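/- For every finite simple graph G, the following are equivalent: (1) every induced subgraph H of G with γ_r(H) ≥ 2 satisfies γ_{r2}(H) = 2·γ_r(H); (2) G is a complete graph. -/

import Mathlib

open Finset

section Defs

variable {V : Type*} [Fintype V] [DecidableEq V]

/-- A 2-rainbow dominating function: every vertex assigned `∅` sees both colors
in its neighborhood. -/
def IsRDF (G : SimpleGraph V) (f : V → Finset (Fin 2)) : Prop :=
  ∀ u, f u = ∅ → ∀ c : Fin 2, ∃ v, G.Adj u v ∧ c ∈ f v

/-- The weight of a 2-rainbow dominating function. -/
def rdfWeight (f : V → Finset (Fin 2)) : ℕ := ∑ u, (f u).card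

/-- The 2-rainbow domination number `γ_{r2}`. -/
noncomputable def gammaR2 (G : SimpleGraph V) : ℕ :=
  sInf {w | ∃ f, IsRDF G f ∧ rdfWeight f = w}

/-- A dominating set: every vertex outside has a neighbor inside. -/
def IsDominatingSet (G : SimpleGraph V) (D : Set V) : Prop :=
  ∀ u, u ∉ D → ∃ v ∈ D, G.Adj u v

/-- A weak Roman dominating function: `g : V → {0,1,2}` such that every vertex `u`
with `g u = 0` has a neighbor `v` with `g v ≥ 1` for which the set of vertices with
positive value under `g_{v→u}` is dominating. -/
def IsWRDF (G : SimpleGraph V) (g : V → ℕ) : Prop :=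
  (∀ x, g x ≤ 2) ∧
  ∀ u, g u = 0 → ∃ v, G.Adj u v ∧ 1 ≤ g v ∧
    IsDominatingSet G {x | 1 ≤ (if x = u then g u + 1 else if x = v then g v - 1 else g x)}

/-- The weight of a weak Roman dominating function. -/
def wrdfWeight (g : V → ℕ) : ℕ := ∑ u, g u

/-- The weak Roman domination number `γ_r`. -/
noncomputable def gammaR (G : SimpleGraph V) : ℕ :=
  sInf {w | ∃ g, IsWRDF G g ∧ wrdfWeight g = w}

end Defs


theorem gammaR_le_one_of_complete {W : Type*} [Fintype W] [DecidableEq W] (H : SimpleGraph W)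
    (h : ∀ a b : W, a ≠ b → H.Adj a b) : gammaR H ≤ 1 := by
  rcases isEmpty_or_nonempty W with hW | ⟨⟨w⟩⟩
  · refine le_trans (Nat.sInf_le ⟨fun _ => 0, ⟨fun x => by simp, fun u => hW.elim u⟩, rfl⟩) ?_
    simp [wrdfWeight]
  · refine Nat.sInf_le ⟨fun x => if x = w then 1 else 0, ⟨fun x => ?_, fun u hu => ?_⟩, ?_⟩
    · dsimp only
      split_ifs <;> omega
    · have huw : u ≠ w := by
        rintro rfl
        simp at hu
      refine ⟨w, h u w huw, by simp, fun x hx => ⟨u, by simp, h x u ?_⟩⟩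
      rintro rfl
      simp at hx
    · simp [wrdfWeight]

theorem card_le_gammaR_of_edgeless {W : Type*} [Fintype W] [DecidableEq W] (H : SimpleGraph W)
    (h : ∀ a b : W, ¬ H.Adj a b) : Fintype.card W ≤ gammaR H := by
  refine le_csInf ⟨_, fun _ => 1, ⟨fun x => by simp, fun u hu => by simp at hu⟩, rfl⟩ ?_
  rintro w ⟨g, ⟨-, hg⟩, rfl⟩
  have h1 : ∀ u ∈ (Finset.univ : Finset W), 1 ≤ g u := by
    intro u _
    by_contra hu
    obtain ⟨v, hv, -⟩ := hg u (by omega)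
    exact h u v hv
  have := Finset.sum_le_sum h1
  simpa [wrdfWeight] using this

theorem gammaR2_le_card {W : Type*} [Fintype W] [DecidableEq W] (H : SimpleGraph W) :
    gammaR2 H ≤ Fintype.card W := by
  refine Nat.sInf_le ⟨fun _ => {0}, fun u hu => by simp at hu, ?_⟩
  simp [rdfWeight]

/-- Every induced subgraph `H` with `γ_r(H) ≥ 2` satisfies `γ_{r2}(H) = 2 γ_r(H)` iff
`G` is complete. -/
theorem G2_characterization {V : Type*} [Fintype V] [DecidableEq V]
    (G : SimpleGraph V) :
    (∀ s : Finset V, 2 ≤ gammaR (G.induce (s : Set V)) →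
        gammaR2 (G.induce (s : Set V)) = 2 * gammaR (G.induce (s : Set V))) ↔
      (∀ a b : V, a ≠ b → G.Adj a b) := by
  constructor
  · intro h a b hab
    by_contra hadj
    have hcard : Fintype.card (({a, b} : Finset V) : Set V) = 2 := by
      simp [hab]
    have h1 := card_le_gammaR_of_edgeless (G.induce ((({a, b} : Finset V)) : Set V)) (by
      rintro ⟨x, hx⟩ ⟨y, hy⟩ hxy
      have hxy : G.Adj x y := hxy
      simp only [Finset.coe_insert, Finset.coe_singleton, Set.mem_insert_iff,
        Set.mem_singleton_iff] at hx hy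
      rcases hx with rfl | rfl <;> rcases hy with rfl | rfl
      · exact G.irrefl hxy
      · exact hadj hxy
      · exact hadj hxy.symm
      · exact G.irrefl hxy)
    have h2 := gammaR2_le_card (G.induce ((({a, b} : Finset V)) : Set V))
    have h3 := h {a, b} (by omega)
    omega
  · intro h s hs
    have := gammaR_le_one_of_complete (G.induce (s : Set V)) (fun x y hxy =>
      h x y (fun e => hxy (Subtype.ext e)))
    omega
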